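/- Let T be a nondegenerate triangle in ℝ² with vertices x₁, x₂, x₃ and let 𝒮 be a finite collection of closed segments, each with both endpoints on ∂T and no interior point on ∂T, such that whenever two distinct segments of 𝒮̄ = 𝒮 ∪ {x₁x₂, x₂x₃, x₃x₁} intersect at a point p ∉ {x₁, x₂, x₃}, there is a unique third segment of 𝒮̄ passing through p. Then there do not exist distinct segments ab, cd ∈ 𝒮 with a and c in the interior of the edge x₁x₂ and b and d in the interior of the edge x₁x₃ such that ab and cd intersect. -/

import Mathlib

open Set

/-- The boundary of the triangle with vertices `x1`, `x2`, `x3`. -/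
def triBdry (x1 x2 x3 : ℝ × ℝ) : Set (ℝ × ℝ) :=
  segment ℝ x1 x2 ∪ segment ℝ x2 x3 ∪ segment ℝ x3 x1

/-- The three edges of the triangle with vertices `x1`, `x2`, `x3`. -/
def triEdges (x1 x2 x3 : ℝ × ℝ) : Set (Set (ℝ × ℝ)) :=
  {segment ℝ x1 x2, segment ℝ x2 x3, segment ℝ x3 x1}

/-- The signed area of the parallelogram spanned by `q - p` and `r - p`, scaled by `k`. -/
def orient (k : ℝ) (p q r : ℝ × ℝ) : ℝ :=
  k * ((q.1 - p.1) * (r.2 - p.2) - (q.2 - p.2) * (r.1 - p.1))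

section Orientation

variable {k : ℝ}

theorem orient_rotate (p q r : ℝ × ℝ) : orient k q r p = orient k p q r := by
  unfold orient; ring

theorem orient_swap (p q r : ℝ × ℝ) : orient k q p r = -orient k p q r := by
  unfold orient; ring

theorem orient_self_left (p q : ℝ × ℝ) : orient k p q p = 0 := by
  unfold orient; ring

theorem orient_self_right (p q : ℝ × ℝ) : orient k p q q = 0 := by
  unfold orient; ring

theorem orient_add_smul (p q x y : ℝ × ℝ) (t : ℝ) :
    orient k p q (x + t • (y - x)) = (1 - t) * orient k p q x + t * orient k p q y := by
  simp [orient]; ring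

/-- Interpolation of the affine function `orient k x y` at the points `a`, `b`, `c`. -/
theorem orient_mul_orient (a b c x y z : ℝ × ℝ) :
    orient k b c a * orient k x y z = orient k b c z * orient k x y a +
      orient k c a z * orient k x y b + orient k a b z * orient k x y c := by
  unfold orient; ring

theorem exists_eq_add_smul_of_orient_eq_zero (hk : k ≠ 0) {a b z : ℝ × ℝ} (hab : a ≠ b)
    (h : orient k a b z = 0) : ∃ t : ℝ, z = a + t • (b - a) := by
  have h' : (b.1 - a.1) * (z.2 - a.2) - (b.2 - a.2) * (z.1 - a.1) = 0 :=
    (mul_eq_zero.mp h).resolve_left hk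
  by_cases h1 : b.1 - a.1 = 0
  · have h2 : b.2 - a.2 ≠ 0 := fun h2 => hab (Prod.ext (by linarith) (by linarith))
    refine ⟨(z.2 - a.2) / (b.2 - a.2), Prod.ext ?_ ?_⟩
    · have : z.1 - a.1 = 0 := by simpa [h1, h2] using h'
      simp [h1]; linarith
    · simp; field_simp; ring
  · refine ⟨(z.1 - a.1) / (b.1 - a.1), Prod.ext ?_ ?_⟩
    · simp; field_simp; ring
    · simp; field_simp; linarith

theorem exists_pos_convex_combination_pos {a : ℝ} (ha : 0 < a) (b : ℝ) :
    ∃ e : ℝ, 0 < e ∧ e ≤ 1 ∧ 0 < (1 - e) * a + e * b := by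
  have hb := abs_nonneg b
  have hs : 0 < a + |b| := by linarith
  have he : a / (2 * (a + |b|)) * (a + |b|) = a / 2 := by field_simp
  have he0 : 0 < a / (2 * (a + |b|)) := by positivity
  refine ⟨_, he0, ?_, ?_⟩
  · rw [div_le_one (by positivity)]; linarith
  · nlinarith [mul_le_mul_of_nonneg_left (neg_abs_le b) he0.le]

theorem add_smul_mem_segment {x y : ℝ × ℝ} {t : ℝ} (h0 : 0 ≤ t) (h1 : t ≤ 1) :
    x + t • (y - x) ∈ segment ℝ x y := by
  rw [segment_eq_image']; exact ⟨t, ⟨h0, h1⟩, rfl⟩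

theorem exists_of_mem_segment {x y z : ℝ × ℝ} (h : z ∈ segment ℝ x y) :
    ∃ t : ℝ, 0 ≤ t ∧ t ≤ 1 ∧ z = x + t • (y - x) := by
  rw [segment_eq_image'] at h
  obtain ⟨t, ht, rfl⟩ := h
  exact ⟨t, ht.1, ht.2, rfl⟩

theorem exists_of_mem_openSegment {x y z : ℝ × ℝ} (h : z ∈ openSegment ℝ x y) :
    ∃ t : ℝ, 0 < t ∧ t < 1 ∧ z = x + t • (y - x) := by
  rw [openSegment_eq_image'] at h
  obtain ⟨t, ht, rfl⟩ := h
  exact ⟨t, ht.1, ht.2, rfl⟩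

/-- A nondegenerate segment in `T` which is the whole intersection of `T` with a line. -/
def IsChord (k : ℝ) (T s : Set (ℝ × ℝ)) : Prop :=
  ∃ u v : ℝ × ℝ, u ≠ v ∧ u ∈ T ∧ v ∈ T ∧ s = segment ℝ u v ∧
    ∀ z ∈ T, orient k u v z = 0 → z ∈ s

namespace IsChord

variable {T s s' : Set (ℝ × ℝ)}

theorem subset (hT : Convex ℝ T) (h : IsChord k T s) : s ⊆ T := by
  obtain ⟨u, v, -, hu, hv, rfl, -⟩ := h
  exact hT.segment_subset hu hv

theorem convex (h : IsChord k T s) : Convex ℝ s := by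
  obtain ⟨u, v, -, -, -, rfl, -⟩ := h
  exact convex_segment u v

theorem exists_ne (h : IsChord k T s) (p : ℝ × ℝ) : ∃ q ∈ s, q ≠ p := by
  obtain ⟨u, v, huv, -, -, rfl, -⟩ := h
  by_cases hu : u = p
  · exact ⟨v, right_mem_segment ℝ u v, fun hv => huv (hu.trans hv.symm)⟩
  · exact ⟨u, left_mem_segment ℝ u v, hu⟩

theorem orient_eq_zero (h : IsChord k T s) {p q z : ℝ × ℝ} (hp : p ∈ s) (hq : q ∈ s)
    (hz : z ∈ s) : orient k p q z = 0 := by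
  obtain ⟨u, v, -, -, -, rfl, -⟩ := h
  obtain ⟨a, -, -, rfl⟩ := exists_of_mem_segment hp
  obtain ⟨b, -, -, rfl⟩ := exists_of_mem_segment hq
  obtain ⟨c, -, -, rfl⟩ := exists_of_mem_segment hz
  simp [orient]; right; ring

theorem mem_of_orient_eq_zero (h : IsChord k T s) {p q z : ℝ × ℝ} (hp : p ∈ s) (hq : q ∈ s)
    (hpq : p ≠ q) (hz : z ∈ T) (h0 : orient k p q z = 0) : z ∈ s := by
  obtain ⟨u, v, -, -, -, rfl, hl⟩ := h
  obtain ⟨a, -, -, rfl⟩ := exists_of_mem_segment hp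
  obtain ⟨b, -, -, rfl⟩ := exists_of_mem_segment hq
  have hab : b - a ≠ 0 := fun hab => hpq (by rw [sub_eq_zero.mp hab])
  refine hl z hz ((mul_eq_zero.mp ?_).resolve_left hab)
  rw [← h0]; simp [orient]; ring

theorem eq_of_mem (hT : Convex ℝ T) (h : IsChord k T s) (h' : IsChord k T s') {p q : ℝ × ℝ}
    (hpq : p ≠ q) (hp : p ∈ s) (hq : q ∈ s) (hp' : p ∈ s') (hq' : q ∈ s') : s = s' :=
  Subset.antisymm
    (fun _ hz => h'.mem_of_orient_eq_zero hp' hq' hpq (h.subset hT hz) (h.orient_eq_zero hp hq hz))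
    (fun _ hz => h.mem_of_orient_eq_zero hp hq hpq (h'.subset hT hz)
      (h'.orient_eq_zero hp' hq' hz))

end IsChord

/-- The open triangle with positively oriented vertices `A`, `B`, `C`. -/
def openTriangle (k : ℝ) (A B C : ℝ × ℝ) : Set (ℝ × ℝ) :=
  {X | 0 < orient k A B X ∧ 0 < orient k B C X ∧ 0 < orient k C A X}

/-- In a family of chords in which every crossing on a side of a triangle is also crossed by a
further chord, no chord enters a triangle bounded by chords through one of its corners. -/
theorem not_enters_corner {T : Set (ℝ × ℝ)} (hT : Convex ℝ T)
    {L : Set (Set (ℝ × ℝ))} (hL : L.Finite) (hchord : ∀ s ∈ L, IsChord k T s)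
    (hthird : ∀ s₁ ∈ L, ∀ s₂ ∈ L, s₁ ≠ s₂ → ∀ A B C D : ℝ × ℝ, A ∈ T → B ∈ s₁ → C ∈ s₁ →
      0 < orient k B C A → D ∈ openSegment ℝ B C → D ∈ s₂ →
      ∃ s₃ ∈ L, s₃ ≠ s₂ ∧ D ∈ s₃ ∧ ∃ E ∈ s₃, 0 < orient k B C E)
    {A B C E : ℝ × ℝ} (hpos : 0 < orient k A B C)
    (hAB : ∃ s ∈ L, A ∈ s ∧ B ∈ s) (hBC : ∃ s ∈ L, B ∈ s ∧ C ∈ s) (hCA : ∃ s ∈ L, C ∈ s ∧ A ∈ s)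
    {r : Set (ℝ × ℝ)} (hr : r ∈ L) (hAr : A ∈ r) (hEr : E ∈ r)
    (hABE : 0 < orient k A B E) (hCAE : 0 < orient k C A E) : False := by
  induction hn : {s ∈ L | (s ∩ openTriangle k A B C).Nonempty}.ncard
    using Nat.strong_induction_on generalizing A B C E r with
  | _ n ih =>
  have hfin : {s ∈ L | (s ∩ openTriangle k A B C).Nonempty}.Finite := hL.subset fun _ h => h.1
  have hBCA : 0 < orient k B C A := by rwa [orient_rotate]
  have hmem : (r ∩ openTriangle k A B C).Nonempty := by
    obtain ⟨e, he0, he1, he⟩ := exists_pos_convex_combination_pos hBCA (orient k B C E)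
    refine ⟨A + e • (E - A), (hchord r hr).convex.segment_subset hAr hEr
      (add_smul_mem_segment he0.le he1), ?_, ?_, ?_⟩
    · rw [orient_add_smul, orient_self_left]; simp; positivity
    · rwa [orient_add_smul]
    · rw [orient_add_smul, orient_self_right]; simp; positivity
  obtain ⟨sBC, hsBC, hB, hC⟩ := hBC
  have hsT : ∀ s ∈ L, s ⊆ T := fun s hs => (hchord s hs).subset hT
  have hAT : A ∈ T := hsT r hr hAr
  set u := orient k A B E with hu
  set v := orient k C A E with hv
  obtain ⟨t, ht0, ht1, htuv⟩ : ∃ t : ℝ, 0 < t ∧ t < 1 ∧ (1 - t) * u = t * v :=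
    ⟨u / (u + v), by positivity, by rw [div_lt_one (by positivity)]; linarith, by
      field_simp; ring⟩
  obtain ⟨D, hD⟩ : ∃ D, D = B + t • (C - B) := ⟨_, rfl⟩
  have hoD (p q : ℝ × ℝ) : orient k p q D = (1 - t) * orient k p q B + t * orient k p q C := by
    rw [hD, orient_add_smul]
  have hDopen : D ∈ openSegment ℝ B C := by
    rw [openSegment_eq_image', hD]; exact ⟨t, ⟨ht0, ht1⟩, rfl⟩
  have hDs : D ∈ sBC :=
    (hchord _ hsBC).convex.segment_subset hB hC (openSegment_subset_segment ℝ B C hDopen)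
  have hDA : D ≠ A := by
    rintro rfl
    rw [(hchord _ hsBC).orient_eq_zero hB hC hDs] at hBCA
    exact hBCA.false
  have hAE : A ≠ E := by
    rintro rfl
    rw [hu, orient_self_left] at hABE
    exact hABE.false
  have hDr : D ∈ r := by
    refine (hchord r hr).mem_of_orient_eq_zero hAr hEr hAE (hsT _ hsBC hDs) ?_
    have e1 : orient k A E B = -u := by rw [hu]; unfold orient; ring
    have e2 : orient k A E C = v := by rw [hv]; unfold orient; ring
    rw [hoD, e1, e2]; linarith
  have hne : sBC ≠ r := by
    rintro rfl
    rw [(hchord _ hsBC).orient_eq_zero hB hC hAr] at hBCA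
    exact hBCA.false
  obtain ⟨s₃, hs₃, hs₃r, hDs₃, F, hF, hBCF⟩ :=
    hthird sBC hsBC r hr hne A B C D hAT hB hC hBCA hDopen hDr
  have hABD : orient k A B D = t * orient k A B C := by
    rw [hoD, orient_self_right]; ring
  have hCAD : orient k C A D = (1 - t) * orient k A B C := by
    rw [hoD, orient_self_left, ← orient_rotate C A B]; ring
  have hBDX (X : ℝ × ℝ) : orient k B D X = t * orient k B C X := by
    rw [hD]; simp [orient]; ring
  have hDCX (X : ℝ × ℝ) : orient k D C X = (1 - t) * orient k B C X := by
    rw [hD]; simp [orient]; ring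
  have hDAX (X : ℝ × ℝ) : orient k D A X = t * orient k C A X - (1 - t) * orient k A B X := by
    rw [hD]; simp [orient]; ring
  have hlt {P : Set (ℝ × ℝ)} (hsub : P ⊆ openTriangle k A B C)
      (hP : ∀ X ∈ P, orient k D A X ≠ 0) :
      {s ∈ L | (s ∩ P).Nonempty}.ncard < n := by
    rw [← hn]
    refine ncard_lt_ncard ⟨fun s hs => ⟨hs.1, hs.2.mono (inter_subset_inter_right s hsub)⟩,
      fun h => ?_⟩ hfin
    obtain ⟨X, hXr, hXP⟩ := (h ⟨hr, hmem⟩).2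
    exact hP X hXP ((hchord r hr).orient_eq_zero hDr hAr hXr)
  have h1t : 0 < 1 - t := by linarith
  rcases lt_trichotomy (orient k D A F) 0 with h | h | h
  · refine ih _ (hlt ?_ ?_) (A := D) (B := C) (C := A) (E := F) ?_ ⟨sBC, hsBC, hDs, hC⟩ hCA
      ⟨r, hr, hAr, hDr⟩ hs₃ hDs₃ hF ?_ ?_ rfl
    · rintro X ⟨h1, h2, h3⟩
      rw [orient_swap, hDAX] at h3
      rw [hDCX] at h1
      refine ⟨?_, pos_of_mul_pos_right h1 h1t.le, h2⟩
      have : 0 < t * orient k C A X := by positivity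
      exact pos_of_mul_pos_right (a := 1 - t) (by linarith) h1t.le
    · rintro X ⟨-, -, h3⟩ h0
      rw [orient_swap, h0] at h3
      simp at h3
    · rw [hDCX]; positivity
    · rw [hDCX]; positivity
    · rw [orient_swap]; linarith
  · have hFr : F ∈ r :=
      (hchord r hr).mem_of_orient_eq_zero hDr hAr hDA (hsT _ hs₃ hF) h
    have hDF : D ≠ F := by
      rintro rfl
      rw [(hchord _ hsBC).orient_eq_zero hB hC hDs] at hBCF
      exact hBCF.false
    exact hs₃r ((hchord _ hs₃).eq_of_mem hT (hchord r hr) hDF hDs₃ hF hDr hFr)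
  · refine ih _ (hlt ?_ ?_) (A := D) (B := A) (C := B) (E := F) ?_ ⟨r, hr, hDr, hAr⟩ hAB
      ⟨sBC, hsBC, hB, hDs⟩ hs₃ hDs₃ hF h ?_ rfl
    · rintro X ⟨h1, h2, h3⟩
      rw [hDAX] at h1
      rw [hBDX] at h3
      refine ⟨h2, pos_of_mul_pos_right h3 ht0.le, ?_⟩
      have : 0 < (1 - t) * orient k A B X := by positivity
      exact pos_of_mul_pos_right (a := t) (by linarith) ht0.le
    · rintro X ⟨h1, -, -⟩ h0
      exact h1.ne' h0
    · rw [← orient_rotate, hABD]; positivity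
    · rw [hBDX]; positivity

/-- The closed triangle with positively oriented vertices `x₁`, `x₂`, `x₃`. -/
def closedTriangle (k : ℝ) (x₁ x₂ x₃ : ℝ × ℝ) : Set (ℝ × ℝ) :=
  {z | 0 ≤ orient k x₁ x₂ z ∧ 0 ≤ orient k x₂ x₃ z ∧ 0 ≤ orient k x₃ x₁ z}

theorem convex_closedTriangle (x₁ x₂ x₃ : ℝ × ℝ) : Convex ℝ (closedTriangle k x₁ x₂ x₃) := by
  rw [convex_iff_segment_subset]
  rintro p ⟨p1, p2, p3⟩ q ⟨q1, q2, q3⟩ z hz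
  obtain ⟨t, h0, h1, rfl⟩ := exists_of_mem_segment hz
  have h1t : 0 ≤ 1 - t := by linarith
  refine ⟨?_, ?_, ?_⟩ <;> rw [orient_add_smul] <;> positivity

theorem closedTriangle_rotate (x₁ x₂ x₃ : ℝ × ℝ) :
    closedTriangle k x₂ x₃ x₁ = closedTriangle k x₁ x₂ x₃ := by
  ext z; simp only [closedTriangle, mem_ofPred_eq]; tauto

section Triangle

variable {x₁ x₂ x₃ : ℝ × ℝ}

theorem orient_add_orient_add_orient (hx : orient k x₁ x₂ x₃ = 1) (z : ℝ × ℝ) :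
    orient k x₁ x₂ z + orient k x₂ x₃ z + orient k x₃ x₁ z = 1 := by
  rw [← hx]; unfold orient; ring

theorem left_mem_closedTriangle (hx : orient k x₁ x₂ x₃ = 1) :
    x₁ ∈ closedTriangle k x₁ x₂ x₃ := by
  refine ⟨(orient_self_left _ _).ge, ?_, (orient_self_right _ _).ge⟩
  rw [orient_rotate, hx]; exact zero_le_one

theorem mem_segment_of_orient_eq_zero (hx : orient k x₁ x₂ x₃ = 1) {z : ℝ × ℝ}
    (hz : z ∈ closedTriangle k x₁ x₂ x₃) (h : orient k x₁ x₂ z = 0) : z ∈ segment ℝ x₁ x₂ := by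
  obtain ⟨-, h2, h3⟩ := hz
  have hk : k ≠ 0 := by rintro rfl; simp [orient] at hx
  have h12 : x₁ ≠ x₂ := by rintro rfl; simp [orient] at hx
  obtain ⟨t, rfl⟩ := exists_eq_add_smul_of_orient_eq_zero hk h12 h
  rw [orient_add_smul, orient_self_left, orient_rotate, hx] at h2
  rw [orient_add_smul, orient_self_right, orient_rotate, orient_rotate, hx] at h3
  exact add_smul_mem_segment (by linarith) (by linarith)

theorem isChord_segment (hx : orient k x₁ x₂ x₃ = 1) :
    IsChord k (closedTriangle k x₁ x₂ x₃) (segment ℝ x₁ x₂) := by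
  refine ⟨x₁, x₂, ?_, left_mem_closedTriangle hx, ?_, rfl, fun z hz h =>
    mem_segment_of_orient_eq_zero hx hz h⟩
  · rintro rfl; simp [orient] at hx
  · rw [← closedTriangle_rotate]
    exact left_mem_closedTriangle (by rwa [orient_rotate])

theorem isChord_of_mem_triEdges (hx : orient k x₁ x₂ x₃ = 1) {s : Set (ℝ × ℝ)}
    (hs : s ∈ triEdges x₁ x₂ x₃) : IsChord k (closedTriangle k x₁ x₂ x₃) s := by
  rcases hs with rfl | rfl | rfl
  · exact isChord_segment hx
  · rw [← closedTriangle_rotate]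
    exact isChord_segment (by rwa [orient_rotate])
  · rw [← closedTriangle_rotate, ← closedTriangle_rotate]
    exact isChord_segment (by rwa [orient_rotate, orient_rotate])

theorem mem_triBdry_iff (hx : orient k x₁ x₂ x₃ = 1) {z : ℝ × ℝ} :
    z ∈ triBdry x₁ x₂ x₃ ↔ z ∈ closedTriangle k x₁ x₂ x₃ ∧
      (orient k x₁ x₂ z = 0 ∨ orient k x₂ x₃ z = 0 ∨ orient k x₃ x₁ z = 0) := by
  have key (s) (hs : s ∈ triEdges x₁ x₂ x₃) := isChord_of_mem_triEdges hx hs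
  have hsub (s) (hs : s ∈ triEdges x₁ x₂ x₃) := (key s hs).subset (convex_closedTriangle _ _ _)
  have h12 : segment ℝ x₁ x₂ ∈ triEdges x₁ x₂ x₃ := .inl rfl
  have h23 : segment ℝ x₂ x₃ ∈ triEdges x₁ x₂ x₃ := .inr (.inl rfl)
  have h31 : segment ℝ x₃ x₁ ∈ triEdges x₁ x₂ x₃ := .inr (.inr rfl)
  constructor
  · rintro ((h | h) | h)
    · exact ⟨hsub _ h12 h, .inl ((key _ h12).orient_eq_zero (left_mem_segment ..)
        (right_mem_segment ..) h)⟩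
    · exact ⟨hsub _ h23 h, .inr (.inl ((key _ h23).orient_eq_zero (left_mem_segment ..)
        (right_mem_segment ..) h))⟩
    · exact ⟨hsub _ h31 h, .inr (.inr ((key _ h31).orient_eq_zero (left_mem_segment ..)
        (right_mem_segment ..) h))⟩
  · rintro ⟨hz, h | h | h⟩
    · exact .inl (.inl (mem_segment_of_orient_eq_zero hx hz h))
    · rw [← closedTriangle_rotate] at hz
      exact .inl (.inr (mem_segment_of_orient_eq_zero (by rwa [orient_rotate]) hz h))
    · rw [← closedTriangle_rotate, ← closedTriangle_rotate] at hz
      exact .inr (mem_segment_of_orient_eq_zero (by rwa [orient_rotate, orient_rotate]) hz h)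

theorem isChord_of_openSegment_disjoint_triBdry (hx : orient k x₁ x₂ x₃ = 1) {a b : ℝ × ℝ}
    (hab : a ≠ b) (ha : a ∈ triBdry x₁ x₂ x₃) (hb : b ∈ triBdry x₁ x₂ x₃)
    (h : ∀ p ∈ openSegment ℝ a b, p ∉ triBdry x₁ x₂ x₃) :
    IsChord k (closedTriangle k x₁ x₂ x₃) (segment ℝ a b) := by
  have hk : k ≠ 0 := by rintro rfl; simp [orient] at hx
  rw [mem_triBdry_iff hx] at ha hb
  refine ⟨a, b, hab, ha.1, hb.1, rfl, fun z hz h0 => ?_⟩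
  have hm := h (a + (1 / 2 : ℝ) • (b - a)) (by
    rw [openSegment_eq_image']; exact ⟨1 / 2, by norm_num, rfl⟩)
  have hmT := (convex_closedTriangle (k := k) x₁ x₂ x₃).segment_subset ha.1 hb.1
    (add_smul_mem_segment one_half_pos.le one_half_lt_one.le)
  rw [mem_triBdry_iff hx, not_and] at hm
  replace hm := hm hmT
  push Not at hm
  obtain ⟨m1, m2, m3⟩ := hm
  obtain ⟨t, rfl⟩ := exists_eq_add_smul_of_orient_eq_zero hk hab h0
  obtain ⟨z1, z2, z3⟩ := hz
  obtain ⟨n1, n2, n3⟩ := hmT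
  have m1 := lt_of_le_of_ne n1 m1.symm
  have m2 := lt_of_le_of_ne n2 m2.symm
  have m3 := lt_of_le_of_ne n3 m3.symm
  rw [orient_add_smul] at m1 m2 m3 z1 z2 z3
  refine add_smul_mem_segment ?_ ?_
  · by_contra! ht
    rcases ha.2 with e | e | e
    · rw [e] at m1 z1; nlinarith
    · rw [e] at m2 z2; nlinarith
    · rw [e] at m3 z3; nlinarith
  · by_contra! ht
    rcases hb.2 with e | e | e
    · rw [e] at m1 z1; nlinarith
    · rw [e] at m2 z2; nlinarith
    · rw [e] at m3 z3; nlinarith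

theorem ne_left_of_mem_openSegment (hx : orient k x₁ x₂ x₃ = 1) {B C D : ℝ × ℝ} (hBC : B ≠ C)
    (hB : B ∈ closedTriangle k x₁ x₂ x₃) (hC : C ∈ closedTriangle k x₁ x₂ x₃)
    (hD : D ∈ openSegment ℝ B C) : D ≠ x₁ := by
  have hk : k ≠ 0 := by rintro rfl; simp [orient] at hx
  have h12 : x₁ ≠ x₂ := by rintro rfl; simp [orient] at hx
  have eq_left {z : ℝ × ℝ} (h1 : orient k x₁ x₂ z = 0) (h3 : orient k x₃ x₁ z = 0) : z = x₁ := by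
    obtain ⟨t, rfl⟩ := exists_eq_add_smul_of_orient_eq_zero hk h12 h1
    rw [orient_add_smul, orient_self_right, orient_rotate, orient_rotate, hx] at h3
    have ht : t = 0 := by linarith
    simp [ht]
  obtain ⟨t, h0, h1, rfl⟩ := exists_of_mem_openSegment hD
  intro h
  have e1 := orient_add_smul (k := k) x₁ x₂ B C t
  have e3 := orient_add_smul (k := k) x₃ x₁ B C t
  rw [h, orient_self_left] at e1
  rw [h, orient_self_right] at e3
  obtain ⟨B1, -, B3⟩ := hB
  obtain ⟨C1, -, C3⟩ := hC
  exact hBC ((eq_left (by nlinarith) (by nlinarith)).trans (eq_left (by nlinarith)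
    (by nlinarith)).symm)

theorem notMem_vertices_of_mem_openSegment (hx : orient k x₁ x₂ x₃ = 1) {B C D : ℝ × ℝ}
    (hBC : B ≠ C) (hB : B ∈ closedTriangle k x₁ x₂ x₃) (hC : C ∈ closedTriangle k x₁ x₂ x₃)
    (hD : D ∈ openSegment ℝ B C) : D ∉ ({x₁, x₂, x₃} : Set (ℝ × ℝ)) := by
  rintro (h | h | h)
  · exact ne_left_of_mem_openSegment hx hBC hB hC hD h
  · rw [← closedTriangle_rotate] at hB hC
    exact ne_left_of_mem_openSegment (by rwa [orient_rotate]) hBC hB hC hD h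
  · rw [← closedTriangle_rotate, ← closedTriangle_rotate] at hB hC
    exact ne_left_of_mem_openSegment (by rwa [orient_rotate, orient_rotate]) hBC hB hC hD h

/-- A chord crossing another chord at an inner point of a segment `BC` reaches every side of `BC`
on which the triangle has a point. -/
theorem exists_mem_orient_pos (hx : orient k x₁ x₂ x₃ = 1) {s s' : Set (ℝ × ℝ)}
    (hs : IsChord k (closedTriangle k x₁ x₂ x₃) s)
    (hs' : IsChord k (closedTriangle k x₁ x₂ x₃) s') (hne : s ≠ s') {A B C D : ℝ × ℝ}
    (hA : A ∈ closedTriangle k x₁ x₂ x₃) (hB : B ∈ s) (hC : C ∈ s) (hBCA : 0 < orient k B C A)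
    (hD : D ∈ openSegment ℝ B C) (hDs' : D ∈ s') : ∃ E ∈ s', 0 < orient k B C E := by
  have hT := convex_closedTriangle (k := k) x₁ x₂ x₃
  obtain ⟨E, hE, hED⟩ := hs'.exists_ne D
  have hET := hs'.subset hT hE
  have hBT := hs.subset hT hB
  have hCT := hs.subset hT hC
  have hBC : B ≠ C := by rintro rfl; simp [orient] at hBCA
  have hDs : D ∈ s := hs.convex.segment_subset hB hC (openSegment_subset_segment ℝ B C hD)
  rcases lt_trichotomy (orient k B C E) 0 with h | h | h
  · have pos (x y w : ℝ × ℝ) (hw : orient k x y w = 1)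
        (hnn : ∀ z ∈ closedTriangle k x₁ x₂ x₃, 0 ≤ orient k x y z) : 0 < orient k x y D := by
      obtain ⟨t, h0, h1, rfl⟩ := exists_of_mem_openSegment hD
      rw [orient_add_smul]
      have hB0 := hnn B hBT
      have hC0 := hnn C hCT
      by_contra! hle
      have hB' : orient k x y B = 0 := by nlinarith
      have hC' : orient k x y C = 0 := by nlinarith
      have hA0 := hnn A hA
      have hE0 := hnn E hET
      have ew := orient_mul_orient (k := k) A B C x y w
      have eE := orient_mul_orient (k := k) A B C x y E
      rw [hB', hC', mul_zero, mul_zero, add_zero, add_zero] at ew eE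
      rw [hw, mul_one] at ew
      have hA' : orient k x y A ≠ 0 := by
        intro h0
        rw [h0, mul_zero] at ew
        exact hBCA.ne' ew
      have hA'' := lt_of_le_of_ne hA0 hA'.symm
      have := mul_neg_of_neg_of_pos h hA''
      have := mul_nonneg hBCA.le hE0
      linarith
    have p1 := pos x₁ x₂ x₃ hx fun z hz => hz.1
    have p2 := pos x₂ x₃ x₁ (by rwa [orient_rotate]) fun z hz => hz.2.1
    have p3 := pos x₃ x₁ x₂ (by rwa [orient_rotate, orient_rotate]) fun z hz => hz.2.2
    obtain ⟨e, he, e1, e2, e3⟩ : ∃ e : ℝ, 0 < e ∧ e ≤ orient k x₁ x₂ D ∧ e ≤ orient k x₂ x₃ D ∧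
        e ≤ orient k x₃ x₁ D :=
      ⟨_, lt_min p1 (lt_min p2 p3), min_le_left _ _, (min_le_right _ _).trans (min_le_left _ _),
        (min_le_right _ _).trans (min_le_right _ _)⟩
    have hsum := orient_add_orient_add_orient hx E
    obtain ⟨q1, q2, q3⟩ := hET
    refine ⟨D + (-e) • (E - D), hs'.mem_of_orient_eq_zero hDs' hE hED.symm ⟨?_, ?_, ?_⟩ ?_, ?_⟩
    · rw [orient_add_smul]; nlinarith
    · rw [orient_add_smul]; nlinarith
    · rw [orient_add_smul]; nlinarith
    · rw [orient_add_smul, orient_self_left, orient_self_right]; ring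
    · rw [orient_add_smul, hs.orient_eq_zero hB hC hDs]; nlinarith
  · exact absurd (hs.eq_of_mem hT hs' hED (hs.mem_of_orient_eq_zero hB hC hBC hET h) hDs hE hDs')
      hne
  · exact ⟨E, hE, h⟩

theorem not_crossing_of_le (hx : orient k x₁ x₂ x₃ = 1) {L : Set (Set (ℝ × ℝ))}
    (hL : L.Finite) (hchord : ∀ s ∈ L, IsChord k (closedTriangle k x₁ x₂ x₃) s)
    (hedge : triEdges x₁ x₂ x₃ ⊆ L)
    (hthird : ∀ s₁ ∈ L, ∀ s₂ ∈ L, s₁ ≠ s₂ → ∀ p : ℝ × ℝ, p ∈ s₁ → p ∈ s₂ →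
      p ∉ ({x₁, x₂, x₃} : Set (ℝ × ℝ)) → ∃ s₃ ∈ L, s₃ ≠ s₁ ∧ s₃ ≠ s₂ ∧ p ∈ s₃)
    {α β γ δ : ℝ} (hα : 0 < α) (hα' : α < 1) (hβ : 0 < β) (hγ : 0 < γ) (hγ' : γ < 1) (hδ : 0 < δ)
    (hlt : α < γ ∨ α = γ ∧ δ < β) {a b c d p : ℝ × ℝ}
    (ha : a = x₁ + α • (x₂ - x₁)) (hb : b = x₁ + β • (x₃ - x₁))
    (hc : c = x₁ + γ • (x₂ - x₁)) (hd : d = x₁ + δ • (x₃ - x₁))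
    (hab : segment ℝ a b ∈ L) (hcd : segment ℝ c d ∈ L)
    (hpab : p ∈ segment ℝ a b) (hpcd : p ∈ segment ℝ c d) : False := by
  have hT := convex_closedTriangle (k := k) x₁ x₂ x₃
  have h12 : segment ℝ x₁ x₂ ∈ L := hedge (.inl rfl)
  have h31 : segment ℝ x₃ x₁ ∈ L := hedge (.inr (.inr rfl))
  have hstep : ∀ s₁ ∈ L, ∀ s₂ ∈ L, s₁ ≠ s₂ → ∀ A B C D : ℝ × ℝ,
      A ∈ closedTriangle k x₁ x₂ x₃ → B ∈ s₁ → C ∈ s₁ →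
      0 < orient k B C A → D ∈ openSegment ℝ B C → D ∈ s₂ →
      ∃ s₃ ∈ L, s₃ ≠ s₂ ∧ D ∈ s₃ ∧ ∃ E ∈ s₃, 0 < orient k B C E := by
    intro s₁ h₁ s₂ h₂ hne A B C D hA hB hC hBCA hD hD₂
    have hBC : B ≠ C := by rintro rfl; simp [orient] at hBCA
    obtain ⟨s₃, h₃, h₃₁, h₃₂, hD₃⟩ := hthird s₁ h₁ s₂ h₂ hne D
      ((hchord _ h₁).convex.segment_subset hB hC (openSegment_subset_segment ℝ B C hD)) hD₂
      (notMem_vertices_of_mem_openSegment hx hBC ((hchord _ h₁).subset hT hB)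
        ((hchord _ h₁).subset hT hC) hD)
    exact ⟨s₃, h₃, h₃₂, hD₃,
      exists_mem_orient_pos hx (hchord _ h₁) (hchord _ h₃) h₃₁.symm hA hB hC hBCA hD hD₃⟩
  have ha12 : a ∈ segment ℝ x₁ x₂ := ha ▸ add_smul_mem_segment hα.le hα'.le
  have hc12 : c ∈ segment ℝ x₁ x₂ := hc ▸ add_smul_mem_segment hγ.le hγ'.le
  have ob : orient k x₁ x₂ b = β := by rw [hb, orient_add_smul, orient_self_left, hx]; ring
  have od : orient k x₁ x₂ d = δ := by rw [hd, orient_add_smul, orient_self_left, hx]; ring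
  have oa : orient k x₁ x₂ a = 0 := by
    rw [ha, orient_add_smul, orient_self_left, orient_self_right]; ring
  have ox₁a (z : ℝ × ℝ) : orient k x₁ a z = α * orient k x₁ x₂ z := by
    rw [ha]; simp [orient]; ring
  have oac (z : ℝ × ℝ) : orient k a c z = (γ - α) * orient k x₁ x₂ z := by
    rw [ha, hc]; simp [orient]; ring
  have hb31 : b ∈ segment ℝ x₃ x₁ := by
    rw [segment_symm]
    have hb1 := ((hchord _ hab).subset hT (right_mem_segment ℝ a b)).2.1
    rw [hb, orient_add_smul, orient_self_right, orient_rotate, hx] at hb1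
    exact hb ▸ add_smul_mem_segment hβ.le (by linarith)
  have hcorner : ∀ r ∈ L, a ∈ r → ∀ E ∈ r, 0 < orient k a b E → 0 < orient k x₁ x₂ E → False := by
    intro r hr har E hE h1 h2
    refine not_enters_corner hT hL hchord hstep (A := a) (B := b) (C := x₁) (E := E) ?_
      ⟨_, hab, left_mem_segment .., right_mem_segment ..⟩
      ⟨_, h31, hb31, right_mem_segment ..⟩ ⟨_, h12, left_mem_segment .., ha12⟩ hr har hE h1 ?_
    · rw [orient_rotate, ox₁a, ob]; positivity
    · rw [ox₁a]; positivity
  rcases hlt with hlt | ⟨rfl, hlt⟩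
  · have hne (q : ℝ × ℝ) (s : Set (ℝ × ℝ)) (hq : q ∈ s) (hq0 : 0 < orient k x₁ x₂ q) :
        segment ℝ x₁ x₂ ≠ s := by
      rintro rfl
      exact hq0.ne' ((hchord _ h12).orient_eq_zero (left_mem_segment ..) (right_mem_segment ..) hq)
    have hx₃ : x₃ ∈ closedTriangle k x₁ x₂ x₃ :=
      (hchord _ h31).subset hT (left_mem_segment ..)
    obtain ⟨r, hr, hrab, har, E, hE, hE0⟩ := hstep _ h12 _ hab
      (hne b _ (right_mem_segment ..) (by rwa [ob])) x₃ x₁ x₂ a hx₃ (left_mem_segment ..)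
      (right_mem_segment ..) (by rw [hx]; exact one_pos)
      (by rw [openSegment_eq_image', ha]; exact ⟨α, ⟨hα, hα'⟩, rfl⟩) (left_mem_segment ..)
    rcases lt_trichotomy (orient k a b E) 0 with h | h | h
    · obtain ⟨t, ht0, -, hp⟩ := exists_of_mem_segment hpab
      have ht : 0 < t := by
        refine lt_of_le_of_ne ht0 ?_
        rintro rfl
        have hpa : p = a := by simpa using hp
        have hac : a ≠ c := by
          rintro rfl
          have := oac x₃
          rw [hx] at this
          simp only [orient, sub_self, zero_mul, mul_zero, mul_one] at this
          linarith
        exact hne d _ (right_mem_segment ..) (by rwa [od]) ((hchord _ h12).eq_of_mem hT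
          (hchord _ hcd) hac ha12 hc12 (hpa ▸ hpcd) (left_mem_segment ..))
      have hγα : 0 < γ - α := by linarith
      refine not_enters_corner hT hL hchord hstep (A := a) (B := c) (C := p) (E := E) ?_
        ⟨_, h12, ha12, hc12⟩ ⟨_, hcd, left_mem_segment .., hpcd⟩
        ⟨_, hab, hpab, left_mem_segment ..⟩ hr har hE ?_ ?_
      · rw [oac, hp, orient_add_smul, oa, ob, mul_zero, zero_add]; positivity
      · rw [oac]; positivity
      · have : orient k p a E = t * -orient k a b E := by rw [hp]; simp [orient]; ring
        rw [this]
        exact mul_pos ht (neg_pos.mpr h)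
    · have hab' : a ≠ b := by
        rintro rfl
        linarith
      have haE : a ≠ E := by
        rintro rfl
        linarith
      have hEab := (hchord _ hab).mem_of_orient_eq_zero (left_mem_segment ..)
        (right_mem_segment ..) hab' ((hchord _ hr).subset hT hE) h
      exact hrab ((hchord _ hr).eq_of_mem hT (hchord _ hab) haE har hE (left_mem_segment ..) hEab)
    · exact hcorner r hr har E hE h hE0
  · have hac : a = c := ha.trans hc.symm
    refine hcorner _ hcd (hac ▸ left_mem_segment ..) d (right_mem_segment ..) ?_ (by rwa [od])
    have : orient k a b d = α * (β - δ) * orient k x₁ x₂ x₃ := by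
      rw [ha, hb, hd]; simp [orient]; ring
    rw [this, hx]
    have := sub_pos.mpr hlt
    positivity

end Triangle

end Orientation

theorem orient_one_ne_zero_of_affineIndependent {x₁ x₂ x₃ : ℝ × ℝ}
    (h : AffineIndependent ℝ ![x₁, x₂, x₃]) : orient 1 x₁ x₂ x₃ ≠ 0 := by
  intro h0
  have h12 : x₁ ≠ x₂ := h.injective.ne (show (0 : Fin 3) ≠ 1 by decide)
  rw [affineIndependent_iff_not_collinear_set] at h
  obtain ⟨t, ht⟩ := exists_eq_add_smul_of_orient_eq_zero one_ne_zero h12 h0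
  refine h ((collinear_iff_of_mem (p₀ := x₁) (by simp)).mpr ⟨x₂ - x₁, ?_⟩)
  rintro p (rfl | rfl | rfl)
  · exact ⟨0, by simp⟩
  · exact ⟨1, by simp⟩
  · exact ⟨t, by rw [vadd_eq_add, add_comm]; exact ht⟩

/-- In a triangular arrangement, two distinct segments `ab`, `cd` of `𝒮` with
`a, c` interior to the edge `x₁x₂` and `b, d` interior to the edge `x₁x₃`
cannot intersect. -/
theorem triangular_arrangement_no_crossing_same_pair
    (x₁ x₂ x₃ : ℝ × ℝ) (hindep : AffineIndependent ℝ ![x₁, x₂, x₃])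
    (S : Set (Set (ℝ × ℝ))) (hfin : S.Finite)
    (hwf : ∀ s ∈ S, ∃ a b : ℝ × ℝ, a ≠ b ∧ s = segment ℝ a b ∧
      a ∈ triBdry x₁ x₂ x₃ ∧ b ∈ triBdry x₁ x₂ x₃ ∧
      ∀ p ∈ openSegment ℝ a b, p ∉ triBdry x₁ x₂ x₃)
    (htriple : ∀ s₁ ∈ S ∪ triEdges x₁ x₂ x₃, ∀ s₂ ∈ S ∪ triEdges x₁ x₂ x₃, s₁ ≠ s₂ →
      ∀ p : ℝ × ℝ, p ∈ s₁ → p ∈ s₂ → p ∉ ({x₁, x₂, x₃} : Set (ℝ × ℝ)) →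
      ∃! s₃, s₃ ∈ S ∪ triEdges x₁ x₂ x₃ ∧ s₃ ≠ s₁ ∧ s₃ ≠ s₂ ∧ p ∈ s₃) :
    ¬ ∃ a b c d : ℝ × ℝ,
      a ∈ openSegment ℝ x₁ x₂ ∧ c ∈ openSegment ℝ x₁ x₂ ∧
      b ∈ openSegment ℝ x₁ x₃ ∧ d ∈ openSegment ℝ x₁ x₃ ∧
      segment ℝ a b ∈ S ∧ segment ℝ c d ∈ S ∧ segment ℝ a b ≠ segment ℝ c d ∧
      (segment ℝ a b ∩ segment ℝ c d).Nonempty := by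
  obtain ⟨k, hx⟩ : ∃ k, orient k x₁ x₂ x₃ = 1 := by
    have h := orient_one_ne_zero_of_affineIndependent hindep
    refine ⟨1 / orient 1 x₁ x₂ x₃, ?_⟩
    nth_rw 1 [orient]
    rw [orient, one_mul] at *
    exact one_div_mul_cancel h
  have hL : (S ∪ triEdges x₁ x₂ x₃).Finite := hfin.union (by simp [triEdges])
  have hchord : ∀ s ∈ S ∪ triEdges x₁ x₂ x₃, IsChord k (closedTriangle k x₁ x₂ x₃) s := by
    rintro s (hs | hs)
    · obtain ⟨a, b, hab, rfl, ha, hb, h⟩ := hwf s hs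
      exact isChord_of_openSegment_disjoint_triBdry hx hab ha hb h
    · exact isChord_of_mem_triEdges hx hs
  have hthird : ∀ s₁ ∈ S ∪ triEdges x₁ x₂ x₃, ∀ s₂ ∈ S ∪ triEdges x₁ x₂ x₃, s₁ ≠ s₂ →
      ∀ p : ℝ × ℝ, p ∈ s₁ → p ∈ s₂ → p ∉ ({x₁, x₂, x₃} : Set (ℝ × ℝ)) →
      ∃ s₃ ∈ S ∪ triEdges x₁ x₂ x₃, s₃ ≠ s₁ ∧ s₃ ≠ s₂ ∧ p ∈ s₃ :=
    fun s₁ h₁ s₂ h₂ hne p hp₁ hp₂ hp => (htriple s₁ h₁ s₂ h₂ hne p hp₁ hp₂ hp).exists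
  rintro ⟨a, b, c, d, ha, hc, hb, hd, hab, hcd, hne, p, hpab, hpcd⟩
  obtain ⟨α, hα, hα', rfl⟩ := exists_of_mem_openSegment ha
  obtain ⟨β, hβ, -, rfl⟩ := exists_of_mem_openSegment hb
  obtain ⟨γ, hγ, hγ', rfl⟩ := exists_of_mem_openSegment hc
  obtain ⟨δ, hδ, -, rfl⟩ := exists_of_mem_openSegment hd
  have key (hlt : α < γ ∨ α = γ ∧ δ < β) : False :=
    not_crossing_of_le hx hL hchord subset_union_right hthird hα hα' hβ hγ hγ' hδ hlt rfl rfl rfl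
      rfl (.inl hab) (.inl hcd) hpab hpcd
  have key' (hlt : γ < α ∨ γ = α ∧ β < δ) : False :=
    not_crossing_of_le hx hL hchord subset_union_right hthird hγ hγ' hδ hα hα' hβ hlt rfl rfl rfl
      rfl (.inl hcd) (.inl hab) hpcd hpab
  rcases lt_trichotomy α γ with h | rfl | h
  · exact key (.inl h)
  · rcases lt_trichotomy β δ with h | rfl | h
    · exact key' (.inr ⟨rfl, h⟩)
    · exact hne rfl
    · exact key (.inr ⟨rfl, h⟩)
  · exact key' (.inl h)
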